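/- Let p : [0,1] → [1,∞] be Lebesgue measurable with ∫_0^1 φ_{p(x)}(λ) dx < ∞ for every λ > 0, and let f : [0,∞) → X be asymptotically almost automorphic, i.e. f = g|_{[0,∞)} + q where g : ℝ → X is almost automorphic and q : [0,∞) → X is continuous with q(t) → 0 as t → +∞. Then f is asymptotically Stepanov p(x)-almost automorphic. -/

import Mathlib

open MeasureTheory Filter Topology Set
open scoped ENNReal

noncomputable section

/-- φ_{p(x)}(t): t^{p(x)} if p(x) < ∞; if p(x) = ∞ then 0 for t ≤ 1 and ∞ for t > 1. -/
def phiVar (p : ℝ → ℝ≥0∞) (x : ℝ) (t : ℝ) : ℝ≥0∞ :=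
  if p x ≠ ∞ then ENNReal.ofReal (t ^ (p x).toReal)
  else if t ≤ 1 then 0 else ∞

/-- ρ(u) := ∫_{[0,1]} φ_{p(x)}(u(x)) dx, for a scalar (norm-valued) function u. -/
def rhoVar (p : ℝ → ℝ≥0∞) (u : ℝ → ℝ) : ℝ≥0∞ :=
  ∫⁻ x in Set.Icc (0:ℝ) 1, phiVar p x (u x)

/-- Membership in L^{p(x)}([0,1]:E). -/
def MemLpVar {E : Type*} [NormedAddCommGroup E] (p : ℝ → ℝ≥0∞) (f : ℝ → E) : Prop :=
  AEStronglyMeasurable f (volume.restrict (Set.Icc (0:ℝ) 1)) ∧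
    ∃ c : ℝ, 0 < c ∧ rhoVar p (fun x => c * ‖f x‖) < ∞

/-- The Luxemburg norm of f in L^{p(x)}([0,1]:E). -/
def luxNorm {E : Type*} [NormedAddCommGroup E] (p : ℝ → ℝ≥0∞) (f : ℝ → E) : ℝ :=
  sInf {lam : ℝ | 0 < lam ∧ rhoVar p (fun x => ‖f x‖ / lam) ≤ 1}

/-- Stepanov p(x)-boundedness on the interval I. -/
def SBdd {E : Type*} [NormedAddCommGroup E] (p : ℝ → ℝ≥0∞) (I : Set ℝ) (f : ℝ → E) : Prop :=
  (∀ t ∈ I, MemLpVar p (fun x => f (t + x))) ∧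
    BddAbove ((fun t => luxNorm p (fun x => f (t + x))) '' I)

/-- The Stepanov norm ‖f‖_{S^{p(x)}} on the interval I. -/
def SNorm {E : Type*} [NormedAddCommGroup E] (p : ℝ → ℝ≥0∞) (I : Set ℝ) (f : ℝ → E) : ℝ :=
  sSup ((fun t => luxNorm p (fun x => f (t + x))) '' I)

/-- Stepanov p(x)-almost automorphy (AAS^{p(x)}(ℝ:E)). -/
def AASVar {E : Type*} [NormedAddCommGroup E] (p : ℝ → ℝ≥0∞) (f : ℝ → E) : Prop :=
  SBdd p Set.univ f ∧
    ∀ a : ℕ → ℝ, ∃ n : ℕ → ℕ, StrictMono n ∧ ∃ g : ℝ → E, SBdd p Set.univ g ∧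
      ∀ t : ℝ,
        Tendsto (fun k => luxNorm p (fun x => f (a (n k) + t + x) - g (t + x))) atTop (𝓝 0) ∧
        Tendsto (fun k => luxNorm p (fun x => g (t - a (n k) + x) - f (t + x))) atTop (𝓝 0)

/-- The class S_0^{p(x)}([0,∞):E) of Stepanov vanishing functions. -/
def S0Var {E : Type*} [NormedAddCommGroup E] (p : ℝ → ℝ≥0∞) (f : ℝ → E) : Prop :=
  SBdd p (Set.Ici 0) f ∧ Tendsto (fun t => luxNorm p (fun x => f (t + x))) atTop (𝓝 0)

/-- Asymptotic Stepanov p(x)-almost automorphy (AAAS^{p(x)}([0,∞):E)). -/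
def AAASVar {E : Type*} [NormedAddCommGroup E] (p : ℝ → ℝ≥0∞) (f : ℝ → E) : Prop :=
  SBdd p (Set.Ici 0) f ∧
    ∃ g q : ℝ → E, AASVar p g ∧ SBdd p (Set.Ici 0) q ∧
      (∀ t : ℝ, 0 ≤ t → f t = g t + q t) ∧
      Tendsto (fun t => luxNorm p (fun x => q (t + x))) atTop (𝓝 0)

/-- Stepanov p(x)-almost periodicity on I: the map t ↦ f(t+·) is Bohr almost periodic
from I to L^{p(x)}([0,1]:E), i.e. continuous plus the relative density of ε-periods. -/
def APSVar {E : Type*} [NormedAddCommGroup E] (p : ℝ → ℝ≥0∞) (I : Set ℝ) (f : ℝ → E) : Prop :=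
  SBdd p I f ∧
    (∀ t ∈ I, Tendsto (fun s => luxNorm p (fun x => f (s + x) - f (t + x))) (𝓝[I] t) (𝓝 0)) ∧
    ∀ ε : ℝ, 0 < ε → ∃ l : ℝ, 0 < l ∧ ∀ a : ℝ, Set.Icc a (a + l) ⊆ I →
      ∃ τ ∈ Set.Icc a (a + l), ∀ t ∈ I, luxNorm p (fun x => f (t + τ + x) - f (t + x)) ≤ ε

/-- Almost automorphic function ℝ → E. -/
def AlmostAutomorphic {E : Type*} [NormedAddCommGroup E] (f : ℝ → E) : Prop :=
  Continuous f ∧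
    ∀ b : ℕ → ℝ, ∃ n : ℕ → ℕ, StrictMono n ∧ ∃ g : ℝ → E,
      (∀ t : ℝ, Tendsto (fun k => f (t + b (n k))) atTop (𝓝 (g t))) ∧
      (∀ t : ℝ, Tendsto (fun k => g (t - b (n k))) atTop (𝓝 (f t)))

/-- Compactly almost automorphic function ℝ → E. -/
def CompactAA {E : Type*} [NormedAddCommGroup E] (f : ℝ → E) : Prop :=
  Continuous f ∧
    ∀ b : ℕ → ℝ, ∃ n : ℕ → ℕ, StrictMono n ∧ ∃ g : ℝ → E,
      (∀ K : Set ℝ, IsCompact K →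
        TendstoUniformlyOn (fun k t => f (t + b (n k))) g atTop K) ∧
      (∀ K : Set ℝ, IsCompact K →
        TendstoUniformlyOn (fun k t => g (t - b (n k))) f atTop K)

/-- Two-parameter Stepanov p(x)-almost automorphy (AAS^{p(x)}(ℝ×F:E)). -/
def AAS2Var {E F : Type*} [NormedAddCommGroup E] [NormedAddCommGroup F]
    (p : ℝ → ℝ≥0∞) (f : ℝ → F → E) : Prop :=
  (∀ y : F, SBdd p Set.univ (fun t => f t y)) ∧
    ∀ a : ℕ → ℝ, ∃ n : ℕ → ℕ, StrictMono n ∧ ∃ g : ℝ → F → E,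
      (∀ y : F, SBdd p Set.univ (fun t => g t y)) ∧
      ∀ (t : ℝ) (y : F),
        Tendsto (fun k => luxNorm p (fun x => f (t + a (n k) + x) y - g (t + x) y)) atTop (𝓝 0) ∧
        Tendsto (fun k => luxNorm p (fun x => g (t - a (n k) + x) y - f (t + x) y)) atTop (𝓝 0)


lemma aux_phi_mono (p : ℝ → ℝ≥0∞) (x : ℝ) {s t : ℝ} (hs : 0 ≤ s) (hst : s ≤ t) :
    phiVar p x s ≤ phiVar p x t := by
  unfold phiVar
  split_ifs with h h1 h2
  · exact ENNReal.ofReal_le_ofReal (Real.rpow_le_rpow hs hst ENNReal.toReal_nonneg)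
  · exact le_rfl
  · exact bot_le
  · exact absurd (hst.trans ‹t ≤ 1›) h1
  · exact le_rfl

lemma aux_phi_meas (p : ℝ → ℝ≥0∞) (hp : Measurable p) :
    Measurable (fun z : ℝ × ℝ => phiVar p z.1 z.2) := by
  unfold phiVar
  refine Measurable.ite ?_ ?_ ?_
  · exact ((hp.comp measurable_fst) (measurableSet_singleton (∞ : ℝ≥0∞))).compl
  · exact (measurable_snd.pow (hp.comp measurable_fst).ennreal_toReal).ennreal_ofReal
  · exact Measurable.ite (measurableSet_le measurable_snd measurable_const)
      measurable_const measurable_const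

lemma aux_phi_scale (p : ℝ → ℝ≥0∞) (x : ℝ) (hp1 : 1 ≤ p x) {M N : ℝ} (hM : 0 ≤ M) (hN : 1 ≤ N) :
    phiVar p x (M / N) ≤ ENNReal.ofReal (1 / N) * phiVar p x M := by
  have hN0 : 0 < N := by linarith
  unfold phiVar
  by_cases h : p x ≠ ∞
  · rw [if_pos h, if_pos h, ← ENNReal.ofReal_mul (by positivity)]
    apply ENNReal.ofReal_le_ofReal
    have h1 : 1 ≤ (p x).toReal := by
      have := ENNReal.toReal_mono h hp1
      simpa using this
    have h2 : M / N = (1 / N) * M := by ring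
    rw [h2, Real.mul_rpow (by positivity) hM]
    apply mul_le_mul_of_nonneg_right _ (by positivity)
    exact Real.rpow_le_self_of_le_one (by positivity) ((div_le_one hN0).2 hN) h1
  · rw [if_neg h, if_neg h]
    by_cases hM1 : M ≤ 1
    · rw [if_pos ((div_le_self hM hN).trans hM1)]
      exact bot_le
    · rw [if_neg hM1, ENNReal.mul_top]
      · exact le_top
      · simpa using hN0

lemma aux_phi_tendsto (p : ℝ → ℝ≥0∞) (x : ℝ) (hp1 : 1 ≤ p x) {ι : Type*} {l : Filter ι}
    {u : ι → ℝ} (hu : Tendsto u l (𝓝 0)) :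
    Tendsto (fun i => phiVar p x (u i)) l (𝓝 0) := by
  unfold phiVar
  by_cases h : p x ≠ ∞
  · simp only [if_pos h]
    have h1 : 0 < (p x).toReal := ENNReal.toReal_pos (by intro h0; simp [h0] at hp1) h
    have := ENNReal.tendsto_ofReal (hu.rpow_const (p := (p x).toReal) (Or.inr h1.le))
    simpa [Real.zero_rpow h1.ne'] using this
  · simp only [if_neg h]
    refine tendsto_const_nhds.congr' ?_
    filter_upwards [hu.eventually (ge_mem_nhds (zero_lt_one))] with i hi
    rw [if_pos hi]

lemma aux_lux_le {E : Type*} [NormedAddCommGroup E] (p : ℝ → ℝ≥0∞) (f : ℝ → E) {lam : ℝ}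
    (h0 : 0 < lam) (h : rhoVar p (fun x => ‖f x‖ / lam) ≤ 1) : luxNorm p f ≤ lam :=
  csInf_le ⟨0, fun _ hy => hy.1.le⟩ ⟨h0, h⟩

lemma aux_lux_nonneg {E : Type*} [NormedAddCommGroup E] (p : ℝ → ℝ≥0∞) (f : ℝ → E) :
    0 ≤ luxNorm p f :=
  Real.sInf_nonneg fun _ hy => hy.1.le

lemma aux_sbdd {E : Type*} [NormedAddCommGroup E] (p : ℝ → ℝ≥0∞)
    (hp1 : ∀ x ∈ Set.Icc (0:ℝ) 1, 1 ≤ p x)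
    (hint : ∀ lam : ℝ, 0 < lam → (∫⁻ x in Set.Icc (0:ℝ) 1, phiVar p x lam) < ∞)
    (I : Set ℝ) (u : ℝ → E) (M : ℝ) (hM : 0 < M)
    (hm : ∀ t ∈ I, AEStronglyMeasurable (fun x => u (t + x)) (volume.restrict (Set.Icc (0:ℝ) 1)))
    (hb : ∀ t ∈ I, ∀ x ∈ Set.Icc (0:ℝ) 1, ‖u (t + x)‖ ≤ M) : SBdd p I u := by
  refine ⟨fun t ht => ⟨hm t ht, 1, one_pos, ?_⟩, ?_⟩
  · refine lt_of_le_of_lt ?_ (hint M hM)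
    refine setLIntegral_mono' measurableSet_Icc fun x hx => ?_
    simp only [one_mul]
    exact aux_phi_mono p x (norm_nonneg _) (hb t ht x hx)
  · set J := ∫⁻ x in Set.Icc (0:ℝ) 1, phiVar p x M with hJ
    have hJt : J ≠ ∞ := (hint M hM).ne
    set N : ℝ := max 1 J.toReal with hN
    have hN1 : 1 ≤ N := le_max_left _ _
    have hN0 : 0 < N := by linarith
    refine ⟨N, ?_⟩
    rintro _ ⟨t, ht, rfl⟩
    refine aux_lux_le p _ hN0 ?_
    calc rhoVar p (fun x => ‖u (t + x)‖ / N)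
        ≤ ∫⁻ x in Set.Icc (0:ℝ) 1, ENNReal.ofReal (1 / N) * phiVar p x M := by
          refine setLIntegral_mono' measurableSet_Icc fun x hx => ?_
          refine (aux_phi_mono p x (by positivity) ?_).trans
            (aux_phi_scale p x (hp1 x hx) hM.le hN1)
          exact div_le_div_of_nonneg_right (hb t ht x hx) hN0.le
      _ = ENNReal.ofReal (1 / N) * J := lintegral_const_mul' _ _ ENNReal.ofReal_ne_top
      _ = ENNReal.ofReal (1 / N * J.toReal) := by
          rw [ENNReal.ofReal_mul (by positivity), ENNReal.ofReal_toReal hJt]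
      _ ≤ 1 := by
          rw [ENNReal.ofReal_le_one, one_div, inv_mul_le_iff₀ hN0, mul_one]
          exact le_max_right _ _

lemma aux_lux_tendsto {E : Type*} [NormedAddCommGroup E] (p : ℝ → ℝ≥0∞) (hp : Measurable p)
    (hp1 : ∀ x ∈ Set.Icc (0:ℝ) 1, 1 ≤ p x)
    (hint : ∀ lam : ℝ, 0 < lam → (∫⁻ x in Set.Icc (0:ℝ) 1, phiVar p x lam) < ∞)
    {ι : Type*} {l : Filter ι} [l.IsCountablyGenerated] (u : ι → ℝ → E) (M : ℝ) (hM : 0 < M)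
    (hm : ∀ᶠ i in l, AEStronglyMeasurable (u i) (volume.restrict (Set.Icc (0:ℝ) 1)))
    (hb : ∀ᶠ i in l, ∀ x ∈ Set.Icc (0:ℝ) 1, ‖u i x‖ ≤ M)
    (ht : ∀ x ∈ Set.Icc (0:ℝ) 1, Tendsto (fun i => u i x) l (𝓝 0)) :
    Tendsto (fun i => luxNorm p (u i)) l (𝓝 0) := by
  have key : ∀ ε : ℝ, 0 < ε → ∀ᶠ i in l, luxNorm p (u i) ≤ ε := by
    intro ε hε
    have h : Tendsto (fun i => rhoVar p (fun x => ‖u i x‖ / ε)) l (𝓝 0) := by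
      have := tendsto_lintegral_filter_of_dominated_convergence'
        (μ := volume.restrict (Set.Icc (0:ℝ) 1)) (l := l)
        (F := fun i x => phiVar p x (‖u i x‖ / ε)) (f := fun _ => 0)
        (fun x => phiVar p x (M / ε)) ?_ ?_ ?_ ?_
      · simpa [rhoVar] using this
      · filter_upwards [hm] with i hi
        exact (aux_phi_meas p hp).comp_aemeasurable
          (aemeasurable_id.prodMk (hi.norm.aemeasurable.div_const ε))
      · filter_upwards [hb] with i hi
        refine (ae_restrict_iff' measurableSet_Icc).2 (Eventually.of_forall fun x hx => ?_)
        exact aux_phi_mono p x (by positivity) (div_le_div_of_nonneg_right (hi x hx) hε.le)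
      · exact (hint _ (div_pos hM hε)).ne
      · refine (ae_restrict_iff' measurableSet_Icc).2 (Eventually.of_forall fun x hx => ?_)
        refine aux_phi_tendsto p x (hp1 x hx) ?_
        simpa using (ht x hx).norm.div_const ε
    filter_upwards [h.eventually (ge_mem_nhds zero_lt_one)] with i hi
    exact aux_lux_le p _ hε hi
  rw [Metric.tendsto_nhds]
  intro ε hε
  filter_upwards [key (ε / 2) (by linarith)] with i hi
  rw [Real.dist_eq, sub_zero, abs_of_nonneg (aux_lux_nonneg p _)]
  linarith

lemma aux_aa_bdd {E : Type*} [NormedAddCommGroup E] (g : ℝ → E) (hg : AlmostAutomorphic g) :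
    ∃ M : ℝ, 0 < M ∧ ∀ t, ‖g t‖ ≤ M := by
  by_contra! hcon
  choose b hb using fun k : ℕ => hcon (k + 1) (by positivity)
  obtain ⟨n, hn, h, h1, -⟩ := hg.2 b
  have h2 := (h1 0).norm
  simp only [zero_add] at h2
  refine not_tendsto_nhds_of_tendsto_atTop ?_ _ h2
  refine tendsto_atTop_mono (fun k => (hb (n k)).le) ?_
  exact tendsto_atTop_add_const_right _ _
    (tendsto_natCast_atTop_atTop.comp hn.tendsto_atTop)

lemma aux_aa_aas {E : Type*} [NormedAddCommGroup E] (p : ℝ → ℝ≥0∞) (hp : Measurable p)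
    (hp1 : ∀ x ∈ Set.Icc (0:ℝ) 1, 1 ≤ p x)
    (hint : ∀ lam : ℝ, 0 < lam → (∫⁻ x in Set.Icc (0:ℝ) 1, phiVar p x lam) < ∞)
    (g : ℝ → E) (hg : AlmostAutomorphic g) : AASVar p g := by
  obtain ⟨M, hM, hb⟩ := aux_aa_bdd g hg
  have hgm : StronglyMeasurable g := hg.1.stronglyMeasurable
  have sh : ∀ (v : ℝ → E), StronglyMeasurable v → ∀ t : ℝ,
      StronglyMeasurable (fun x => v (t + x)) := fun v hv t =>
    hv.comp_measurable (measurable_const_add t)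
  refine ⟨aux_sbdd p hp1 hint _ g M hM (fun t _ => (sh g hgm t).aestronglyMeasurable)
    (fun t _ x _ => hb _), fun a => ?_⟩
  obtain ⟨n, hn, h, h1, h2⟩ := hg.2 a
  have hhm : StronglyMeasurable h := by
    refine stronglyMeasurable_of_tendsto atTop
      (f := fun k t => g (t + a (n k))) (fun k => ?_) (tendsto_pi_nhds.2 h1)
    exact hgm.comp_measurable (measurable_add_const _)
  have hhb : ∀ t, ‖h t‖ ≤ M := fun t =>
    le_of_tendsto (h1 t).norm (Eventually.of_forall fun k => hb _)
  refine ⟨n, hn, h, aux_sbdd p hp1 hint _ h M hM (fun t _ => (sh h hhm t).aestronglyMeasurable)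
    (fun t _ x _ => hhb _), fun t => ⟨?_, ?_⟩⟩
  · refine aux_lux_tendsto p hp hp1 hint _ (M + M) (by linarith) ?_ ?_ ?_
    · exact Eventually.of_forall fun k => ((sh g hgm _).sub (sh h hhm _)).aestronglyMeasurable
    · exact Eventually.of_forall fun k x _ =>
        (norm_sub_le _ _).trans (add_le_add (hb _) (hhb _))
    · intro x _
      have := (h1 (t + x)).sub_const (h (t + x))
      rw [sub_self] at this
      refine this.congr fun k => ?_
      rw [show t + x + a (n k) = a (n k) + t + x by ring]
  · refine aux_lux_tendsto p hp hp1 hint _ (M + M) (by linarith) ?_ ?_ ?_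
    · exact Eventually.of_forall fun k => ((sh h hhm _).sub (sh g hgm _)).aestronglyMeasurable
    · exact Eventually.of_forall fun k x _ =>
        (norm_sub_le _ _).trans (add_le_add (hhb _) (hb _))
    · intro x _
      have := (h2 (t + x)).sub_const (g (t + x))
      rw [sub_self] at this
      refine this.congr fun k => ?_
      rw [show t + x - a (n k) = t - a (n k) + x by ring]

lemma aux_cont_shift {E : Type*} [NormedAddCommGroup E] (v : ℝ → E)
    (hv : ContinuousOn v (Set.Ici 0)) (t : ℝ) (ht : 0 ≤ t) :
    AEStronglyMeasurable (fun x => v (t + x)) (volume.restrict (Set.Icc (0:ℝ) 1)) := by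
  refine ContinuousOn.aestronglyMeasurable ?_ measurableSet_Icc
  refine hv.comp (by fun_prop) fun x hx => ?_
  exact add_nonneg ht hx.1

/-- if ∫_0^1 φ_{p(x)}(λ) dx < ∞ for all λ > 0, then every asymptotically
almost automorphic function is asymptotically Stepanov p(x)-almost automorphic. -/
theorem asymp_almost_automorphic_implies_asymp_stepanov_px_aa
    {X : Type*} [NormedAddCommGroup X] [NormedSpace ℂ X] [CompleteSpace X]
    (p : ℝ → ℝ≥0∞) (hpmeas : Measurable p) (hp1 : ∀ x ∈ Set.Icc (0:ℝ) 1, 1 ≤ p x)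
    (hint : ∀ lam : ℝ, 0 < lam → (∫⁻ x in Set.Icc (0:ℝ) 1, phiVar p x lam) < ∞)
    (f g q : ℝ → X) (hg : AlmostAutomorphic g)
    (hqc : ContinuousOn q (Set.Ici 0)) (hq0 : Filter.Tendsto q Filter.atTop (nhds 0))
    (hdec : ∀ t : ℝ, 0 ≤ t → f t = g t + q t) :
    AAASVar p f := by
  obtain ⟨M, hM, hgb⟩ := aux_aa_bdd g hg
  have hqb : ∃ K : ℝ, 0 < K ∧ ∀ t, 0 ≤ t → ‖q t‖ ≤ K := by
    have h1 : ∀ᶠ t in atTop, ‖q t‖ ≤ 1 := by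
      have := hq0.norm
      rw [norm_zero] at this
      exact this.eventually (ge_mem_nhds zero_lt_one)
    obtain ⟨T, hT⟩ := eventually_atTop.1 h1
    obtain ⟨C, hC⟩ := (isCompact_Icc (a := (0:ℝ)) (b := T)).exists_bound_of_continuousOn
      (hqc.mono Set.Icc_subset_Ici_self)
    refine ⟨max 1 C, by positivity, fun t ht => ?_⟩
    rcases le_total T t with h | h
    · exact (hT t h).trans (le_max_left _ _)
    · exact (hC t ⟨ht, h⟩).trans (le_max_right _ _)
  obtain ⟨K, hK, hqb⟩ := hqb
  have hfc : ContinuousOn f (Set.Ici 0) :=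
    (hg.1.continuousOn.add hqc).congr fun t ht => hdec t ht
  refine ⟨aux_sbdd p hp1 hint _ f (M + K) (by linarith) (aux_cont_shift f hfc)
    fun t ht x hx => ?_, g, q, aux_aa_aas p hpmeas hp1 hint g hg,
    aux_sbdd p hp1 hint _ q K hK (aux_cont_shift q hqc)
      fun t ht x hx => hqb _ (add_nonneg ht hx.1), hdec, ?_⟩
  · rw [hdec _ (add_nonneg ht hx.1)]
    exact (norm_add_le _ _).trans (add_le_add (hgb _) (hqb _ (add_nonneg ht hx.1)))
  · refine aux_lux_tendsto p hpmeas hp1 hint _ K hK ?_ ?_ ?_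
    · filter_upwards [eventually_ge_atTop 0] with t ht
      exact aux_cont_shift q hqc t ht
    · filter_upwards [eventually_ge_atTop 0] with t ht x hx
      exact hqb _ (add_nonneg ht hx.1)
    · intro x _
      exact hq0.comp (tendsto_atTop_add_const_right _ x tendsto_id)

end
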